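/- Let f be a homeomorphism of the closed annulus A = 𝕋 × [0,1] isotopic to the identity, preserving the measure induced by the area form dx∧dy, and let f̃ be a lift of f to Ã = ℝ × [0,1] such that ρ_{f̃}(C₀) < ρ_{f̃}(C₁). Then for every rational number p/q ∈ [ρ_{f̃}(C₀), ρ_{f̃}(C₁)], with p, q coprime and q ≥ 1, there exists a periodic orbit of f of type (p,q) for the lift f̃; in particular there exists z̃ ∈ Ã with f̃^q(z̃) = T^p(z̃). -/

import Mathlib

open Set Filter Topology MeasureTheory

noncomputable section

/-- The circle `𝕋 = ℝ/ℤ`. -/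
abbrev 𝕋 : Type := AddCircle (1 : ℝ)

/-- The closed annulus `A = 𝕋 × [0,1]`. -/
abbrev Ann : Type := 𝕋 × ↥(Set.Icc (0:ℝ) 1)

/-- The universal cover `Ã = ℝ × [0,1]`. -/
abbrev StripA : Type := ℝ × ↥(Set.Icc (0:ℝ) 1)

/-- The covering projection `π : Ã → A`. -/
def annProj : StripA → Ann := fun z => ((z.1 : 𝕋), z.2)

/-- The deck translation `T(x̃,y) = (x̃+1,y)`. -/
def deckT : StripA → StripA := fun z => (z.1 + 1, z.2)

/-- The iterated deck translation `T^p`, `p ∈ ℤ`. -/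
def deckZ (p : ℤ) : StripA → StripA := fun z => (z.1 + (p : ℝ), z.2)

/-- The boundary circle `C₀ = 𝕋 × {0}`. -/
def C0 : Set Ann := {z | (z.2 : ℝ) = 0}

/-- The boundary circle `C₁ = 𝕋 × {1}`. -/
def C1 : Set Ann := {z | (z.2 : ℝ) = 1}

/-- A point of `Ã` on the boundary line `ℝ × {0}`. -/
def bd0 (x : ℝ) : StripA := (x, ⟨0, by norm_num⟩)

/-- A point of `Ã` on the boundary line `ℝ × {1}`. -/
def bd1 (x : ℝ) : StripA := (x, ⟨1, by norm_num⟩)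

/-- A homeomorphism of the closed annulus isotopic to the identity, together with a
chosen lift to the universal cover.  (A homeomorphism of `A` is isotopic to the identity
iff it admits a lift commuting with the deck translation and preserving each boundary
line of the strip.) -/
structure AnnulusHomeo where
  toFun : Ann ≃ₜ Ann
  lift : StripA ≃ₜ StripA
  lift_proj : ∀ z : StripA, annProj (lift z) = toFun (annProj z)
  lift_deck : ∀ z : StripA, lift (deckT z) = deckT (lift z)
  lift_bd0 : ∀ z : StripA, (z.2 : ℝ) = 0 → ((lift z).2 : ℝ) = 0

/-- The iterate `f^k`, `k ∈ ℤ`. -/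
def AnnulusHomeo.iter (h : AnnulusHomeo) (k : ℤ) : Ann → Ann :=
  fun z => ((h.toFun.toEquiv : Equiv.Perm Ann) ^ k) z

/-- The iterate `f̃^k` of the lift, `k ∈ ℤ`. -/
def AnnulusHomeo.liftIter (h : AnnulusHomeo) (k : ℤ) : StripA → StripA :=
  fun z => ((h.lift.toEquiv : Equiv.Perm StripA) ^ k) z

/-- `f` is non wandering: every nonempty open set meets one of its forward iterates. -/
def NonWandering (h : AnnulusHomeo) : Prop :=
  ∀ U : Set Ann, IsOpen U → U.Nonempty → ∃ k : ℕ, 0 < k ∧ (h.iter k '' U ∩ U).Nonempty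

/-- The closed strip `ℝ × [0,1]` inside the plane. -/
def stripS : Set (ℝ × ℝ) := {p | p.2 ∈ Set.Icc (0:ℝ) 1}

/-- A positive twist map: a `C¹` diffeomorphism of the annulus, isotopic to the identity,
whose lift `F` to the strip (together with its inverse `G`) is continuously differentiable
and satisfies `∂(p̃₁ ∘ f̃)/∂y > 0`, i.e. the first component of `DF(z)·(0,1)` is positive. -/
structure PositiveTwistMap extends AnnulusHomeo where
  F : ℝ × ℝ → ℝ × ℝ
  F' : ℝ × ℝ → (ℝ × ℝ) →L[ℝ] (ℝ × ℝ)
  G : ℝ × ℝ → ℝ × ℝ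
  G' : ℝ × ℝ → (ℝ × ℝ) →L[ℝ] (ℝ × ℝ)
  F_lift : ∀ z : StripA, F (z.1, (z.2 : ℝ)) = ((lift z).1, ((lift z).2 : ℝ))
  G_lift : ∀ z : StripA, G (z.1, (z.2 : ℝ)) = ((lift.symm z).1, ((lift.symm z).2 : ℝ))
  F_hasDeriv : ∀ z ∈ stripS, HasFDerivWithinAt F (F' z) stripS z
  G_hasDeriv : ∀ z ∈ stripS, HasFDerivWithinAt G (G' z) stripS z
  F'_cont : ContinuousOn F' stripS
  G'_cont : ContinuousOn G' stripS
  twist_pos : ∀ z ∈ stripS, 0 < (F' z (0, 1)).1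

/-- The oriented angle (in `(-π, π]`) from the vertical vector `(0,1)` to the vector `w`. -/
def angleFromVertical (w : ℝ × ℝ) : ℝ := Complex.arg ⟨w.2, -w.1⟩

/-- `ρ` is the rotation number of `f` on the boundary circle `C₀`, computed with the lift. -/
def HasRotNum0 (h : AnnulusHomeo) (ρ : ℝ) : Prop :=
  ∀ x : ℝ, Tendsto (fun n : ℕ => ((h.liftIter (n : ℤ) (bd0 x)).1 - x) / (n : ℝ))
    atTop (𝓝 ρ)

/-- `ρ` is the rotation number of `f` on the boundary circle `C₁`, computed with the lift. -/
def HasRotNum1 (h : AnnulusHomeo) (ρ : ℝ) : Prop :=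
  ∀ x : ℝ, Tendsto (fun n : ℕ => ((h.liftIter (n : ℤ) (bd1 x)).1 - x) / (n : ℝ))
    atTop (𝓝 ρ)

/-- A closed `f`-invariant set `X ⊆ A` is well ordered if the first projection is injective
on `X` and the lift preserves the horizontal order on `π⁻¹(X)`. -/
def IsWellOrdered (h : AnnulusHomeo) (X : Set Ann) : Prop :=
  IsClosed X ∧ h.toFun '' X = X ∧
  Set.InjOn (fun z : Ann => z.1) X ∧
  ∀ z₁ z₂ : StripA, annProj z₁ ∈ X → annProj z₂ ∈ X → z₁.1 < z₂.1 →
    (h.lift z₁).1 < (h.lift z₂).1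

/-- An essential simple loop in the annulus: the range of an injective continuous map
from the circle that is not null-homotopic. -/
def IsEssentialSimpleLoop (Γ : Set Ann) : Prop :=
  ∃ γ : C(𝕋, Ann), Function.Injective γ ∧ ¬ γ.Nullhomotopic ∧ Set.range γ = Γ

/-- `Γ` meets each vertical segment `{x} × [0,1]` in exactly one point. -/
def MeetsVerticalsOnce (Γ : Set Ann) : Prop :=
  ∀ x : 𝕋, ∃! z : Ann, z ∈ Γ ∧ z.1 = x

/-- No essential simple loop meeting each vertical segment exactly once is invariant,
except the two boundary circles. -/
def NoInvariantTransverseLoop (h : AnnulusHomeo) : Prop :=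
  ∀ Γ : Set Ann, IsEssentialSimpleLoop Γ → MeetsVerticalsOnce Γ →
    h.toFun '' Γ = Γ → Γ = C0 ∨ Γ = C1

/-- A continuum: a nonempty compact connected set. -/
def IsContinuum (X : Set Ann) : Prop := X.Nonempty ∧ IsCompact X ∧ IsPreconnected X

/-- A lower annulus: an open set homeomorphic to `𝕋 × [0,1)` containing `C₀`. -/
def IsLowerAnnulus (U : Set Ann) : Prop :=
  IsOpen U ∧ Nonempty (↥U ≃ₜ (𝕋 × ↥(Set.Ico (0:ℝ) 1))) ∧ C0 ⊆ U

/-- A lower disk: an open set homeomorphic to `ℝ × [0,1)` meeting `C₀`. -/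
def IsLowerDisk (U : Set Ann) : Prop :=
  IsOpen U ∧ Nonempty (↥U ≃ₜ (ℝ × ↥(Set.Ico (0:ℝ) 1))) ∧ (U ∩ C0).Nonempty

/-- A lower annulus is regular if it is a connected component of the complement of an
essential simple loop. -/
def IsRegularLowerAnnulus (U : Set Ann) : Prop :=
  ∃ Γ : Set Ann, IsEssentialSimpleLoop Γ ∧ ∃ z : Ann, U = connectedComponentIn Γᶜ z

/-- A lower disk is regular if it is a connected component of the complement of a simple
arc joining two points of `C₀` and meeting `C₀` only at its endpoints, or of the
complement of an essential simple loop meeting `C₀` in exactly one point. -/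
def IsRegularLowerDisk (U : Set Ann) : Prop :=
  (∃ a : C(↥(Set.Icc (0:ℝ) 1), Ann), Function.Injective a ∧
      (∀ t : ↥(Set.Icc (0:ℝ) 1), a t ∈ C0 ↔ ((t : ℝ) = 0 ∨ (t : ℝ) = 1)) ∧
      ∃ z : Ann, U = connectedComponentIn (Set.range a)ᶜ z) ∨
  (∃ Γ : Set Ann, IsEssentialSimpleLoop Γ ∧ (∃! z : Ann, z ∈ Γ ∩ C0) ∧
      ∃ z : Ann, U = connectedComponentIn Γᶜ z)

end

/-! ### Continuous logarithms of nonvanishing functions -/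

theorem exists_continuousOn_log {E : Type*} [AddCommGroup E] [Module ℝ E] [TopologicalSpace E]
    [IsTopologicalAddGroup E] [ContinuousSMul ℝ E] [LocallyConvexSpace ℝ E] {S : Set E}
    (hS : Convex ℝ S) (hne : S.Nonempty) {φ : E → ℂ} (hφ : ContinuousOn φ S)
    (h0 : ∀ x ∈ S, φ x ≠ 0) :
    ∃ ℓ : E → ℂ, ContinuousOn ℓ S ∧ ∀ x ∈ S, Complex.exp (ℓ x) = φ x := by
  classical
  have := hS.contractibleSpace hne
  have := hS.locallyPathConnectedSpace
  obtain ⟨a, ha⟩ := hne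
  let F : C(S, {z : ℂ // z ≠ 0}) :=
    ⟨fun x => ⟨φ x, h0 x x.2⟩, (continuousOn_iff_continuous_domRestrict.1 hφ).subtype_mk _⟩
  obtain ⟨G, ⟨-, hG⟩, -⟩ := Complex.isCoveringMap_exp.existsUnique_continuousMap_lifts F ⟨a, ha⟩
    (Complex.log (φ a)) (Subtype.ext (Complex.exp_log (h0 a ha)))
  refine ⟨fun x => if hx : x ∈ S then G ⟨x, hx⟩ else 0, ?_, ?_⟩
  · rw [continuousOn_iff_continuous_domRestrict]
    convert G.continuous using 1
    ext x
    simp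
  · intro x hx
    have := congrArg Subtype.val (congrFun hG ⟨x, hx⟩)
    beta_reduce
    rw [dif_pos hx]
    exact this

theorem eqOn_of_exp_eqOn {X : Type*} [TopologicalSpace X] {S : Set X} (hS : IsPreconnected S)
    {ℓ₁ ℓ₂ : X → ℂ} (h₁ : ContinuousOn ℓ₁ S) (h₂ : ContinuousOn ℓ₂ S)
    (he : ∀ x ∈ S, Complex.exp (ℓ₁ x) = Complex.exp (ℓ₂ x)) {a : X} (ha : a ∈ S)
    (hab : ℓ₁ a = ℓ₂ a) : EqOn ℓ₁ ℓ₂ S := by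
  refine Complex.isCoveringMap_exp.eqOn_of_comp_eqOn hS h₁ h₂ ?_ ha hab
  intro x hx
  exact Subtype.ext (he x hx)

/-- On a connected set where the quotients of the values of `v` are positive reals, the imaginary
part of a continuous logarithm of `v` is constant. -/
theorem im_log_eq_of_div_pos {X : Type*} [TopologicalSpace X] {S : Set X} (hS : IsPreconnected S)
    {ℓ v : X → ℂ} (hℓ : ContinuousOn ℓ S) (hv : ContinuousOn v S)
    (he : ∀ x ∈ S, Complex.exp (ℓ x) = v x)
    {a : X} (ha : a ∈ S) (hpos : ∀ x ∈ S, ∃ r : ℝ, 0 < r ∧ v x = r * v a) {x : X} (hx : x ∈ S) :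
    (ℓ x).im = (ℓ a).im := by
  have hva : v a ≠ 0 := by rw [← he a ha]; exact Complex.exp_ne_zero _
  have hq : ∀ y ∈ S, ∃ r : ℝ, 0 < r ∧ v y / v a = r := fun y hy => by
    obtain ⟨r, hr, h⟩ := hpos y hy
    exact ⟨r, hr, by rw [h]; field_simp⟩
  have hc : ContinuousOn (fun y => ℓ a + Complex.log (v y / v a)) S := by
    refine continuousOn_const.add ((hv.div_const _).clog fun y hy => ?_)
    obtain ⟨r, hr, h⟩ := hq y hy
    simp only [h]
    exact Complex.ofReal_mem_slitPlane.2 hr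
  have := eqOn_of_exp_eqOn hS hℓ hc (fun y hy => by
    have hvy : v y ≠ 0 := by rw [← he y hy]; exact Complex.exp_ne_zero _
    rw [Complex.exp_add, Complex.exp_log (div_ne_zero hvy hva), he y hy, he a ha]
    field_simp) ha (by simp [div_self hva]) hx
  obtain ⟨r, hr, h⟩ := hq x hx
  rw [this]
  simp only [h, Complex.add_im, Complex.log_im, Complex.arg_ofReal_of_nonneg hr.le, add_zero]

theorem im_mem_Icc_of_exp_im_nonneg {ℓ : ℝ → ℂ} {S : Set ℝ} (hS : IsPreconnected S)
    (hℓ : ContinuousOn ℓ S) (h : ∀ t ∈ S, 0 ≤ (Complex.exp (ℓ t)).im) {a b : ℝ} (ha : a ∈ S)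
    (hb : b ∈ S) (hia : (ℓ a).im ∈ Icc 0 Real.pi) : (ℓ b).im ∈ Icc 0 Real.pi := by
  have him : IsPreconnected ((fun t => (ℓ t).im) '' S) :=
    hS.image _ (Complex.continuous_im.comp_continuousOn hℓ)
  have hord := him.ordConnected
  have hsin : ∀ y ∈ (fun t => (ℓ t).im) '' S, 0 ≤ Real.sin y := by
    rintro _ ⟨t, ht, rfl⟩
    have := h t ht
    rw [Complex.exp_im] at this
    exact nonneg_of_mul_nonneg_right this (Real.exp_pos _)
  have hA := mem_image_of_mem (fun t => (ℓ t).im) ha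
  have hB := mem_image_of_mem (fun t => (ℓ t).im) hb
  have hpi := Real.pi_pos
  constructor
  · by_contra! hlt
    have hm : max ((ℓ b).im) (-(Real.pi / 2)) ∈ (fun t => (ℓ t).im) '' S :=
      hord.out hB hA ⟨le_max_left _ _, max_le (hlt.le.trans hia.1) (by linarith [hia.1])⟩
    have h1 := hsin _ hm
    have h2 := Real.sin_neg_of_neg_of_neg_pi_lt (x := max ((ℓ b).im) (-(Real.pi / 2)))
      (max_lt hlt (by linarith)) (lt_max_of_lt_right (by linarith))
    linarith
  · by_contra! hlt
    have hm : min ((ℓ b).im) (3 * Real.pi / 2) ∈ (fun t => (ℓ t).im) '' S :=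
      hord.out hA hB ⟨le_min (hia.2.trans hlt.le) (by linarith [hia.2]), min_le_left _ _⟩
    have h1 := hsin _ hm
    have h2 := Real.sin_neg_of_neg_of_neg_pi_lt
      (x := min ((ℓ b).im) (3 * Real.pi / 2) - 2 * Real.pi)
      (by linarith [min_le_right ((ℓ b).im) (3 * Real.pi / 2)])
      (by linarith [lt_min hlt (by linarith : Real.pi < 3 * Real.pi / 2)])
    rw [Real.sin_sub_two_pi] at h2
    linarith

/-- The vector from `z` to `w`, as a complex number. -/
def planeVec (z w : ℝ × ℝ) : ℂ := ⟨w.1 - z.1, w.2 - z.2⟩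

theorem continuous_planeVec {X : Type*} [TopologicalSpace X] {f g : X → ℝ × ℝ} {S : Set X}
    (hf : ContinuousOn f S) (hg : ContinuousOn g S) :
    ContinuousOn (fun x => planeVec (f x) (g x)) S := by
  have : (fun x => planeVec (f x) (g x)) = fun x =>
      (((g x).1 - (f x).1 : ℝ) : ℂ) + (((g x).2 - (f x).2 : ℝ) : ℂ) * Complex.I := by
    ext x
    apply Complex.ext <;> simp [planeVec]
  rw [this]
  fun_prop

theorem planeVec_ne_zero {z w : ℝ × ℝ} (h : z ≠ w) : planeVec z w ≠ 0 := by
  intro h0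
  apply h
  have h1 := congrArg Complex.re h0
  have h2 := congrArg Complex.im h0
  simp only [planeVec, Complex.zero_re, Complex.zero_im] at h1 h2
  exact Prod.ext (by linarith) (by linarith)

/-- If a simple curve satisfies `γ (t + 1) = H (γ t)`, starts at a lowest point and ends at a
highest one, then the direction of the displacement of `H` turns along the curve within a
half-plane. -/
theorem im_log_displacement_mem_Icc {H : ℝ × ℝ → ℝ × ℝ} {γ : ℝ → ℝ × ℝ} {a : ℝ} (ha : 0 ≤ a)
    (hγ : ContinuousOn γ (Icc 0 (a + 1))) (hinj : InjOn γ (Icc 0 (a + 1)))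
    (hH : ∀ t ∈ Icc 0 a, γ (t + 1) = H (γ t))
    (hlow : ∀ t ∈ Icc 0 (a + 1), (γ 0).2 ≤ (γ t).2)
    (hhigh : ∀ t ∈ Icc 0 (a + 1), (γ t).2 ≤ (γ (a + 1)).2)
    {θ : ℝ × ℝ → ℂ} (hθ : Continuous θ) (hexp : ∀ z, Complex.exp (θ z) = planeVec z (H z))
    (h0 : (θ (γ 0)).im ∈ Icc 0 Real.pi) : (θ (γ a)).im ∈ Icc 0 Real.pi := by
  let S : Set (ℝ × ℝ) := {p | 0 ≤ p.1 ∧ p.1 + 1 ≤ p.2 ∧ p.2 ≤ a + 1}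
  have hS : Convex ℝ S := by
    rintro ⟨x, y⟩ ⟨h1, h2, h3⟩ ⟨x', y'⟩ ⟨h1', h2', h3'⟩ s t hs ht hst
    simp only [S, mem_ofPred_eq, Prod.smul_mk, Prod.mk_add_mk, smul_eq_mul] at *
    refine ⟨by positivity, ?_, ?_⟩
    · nlinarith
    · nlinarith
  have hm1 : MapsTo (fun p : ℝ × ℝ => p.1) S (Icc 0 (a + 1)) := fun p hp =>
    ⟨hp.1, by linarith [hp.2.1, hp.2.2]⟩
  have hm2 : MapsTo (fun p : ℝ × ℝ => p.2) S (Icc 0 (a + 1)) := fun p hp =>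
    ⟨by linarith [hp.1, hp.2.1], hp.2.2⟩
  obtain ⟨A, hA, hAe⟩ := exists_continuousOn_log hS ⟨(0, 1), le_rfl, by simp, by simpa using ha⟩
    (φ := fun p => planeVec (γ p.1) (γ p.2))
    (continuous_planeVec (hγ.comp continuousOn_fst hm1) (hγ.comp continuousOn_snd hm2))
    (fun p hp => planeVec_ne_zero fun h => by
      have : p.1 = p.2 := hinj (hm1 hp) (hm2 hp) h
      linarith [hp.2.1])
  set c : ℂ := θ (γ 0) - A (0, 1) with hc
  have h01 : ((0 : ℝ), (1 : ℝ)) ∈ S := ⟨le_rfl, by simp, by simpa using ha⟩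
  have hexpc : Complex.exp c = 1 := by
    rw [hc, Complex.exp_sub, hexp, hAe _ h01, ← hH 0 ⟨le_rfl, ha⟩, zero_add]
    exact div_self (planeVec_ne_zero fun h => by
      have := hinj ⟨le_rfl, by linarith⟩ ⟨zero_le_one, by linarith⟩ h
      norm_num at this)
  have hB : ∀ p ∈ S, Complex.exp (A p + c) = planeVec (γ p.1) (γ p.2) := fun p hp => by
    rw [Complex.exp_add, hexpc, mul_one, hAe p hp]
  have hdiag : A (a, a + 1) + c = θ (γ a) := by
    have hms : MapsTo (fun s : ℝ => (s, s + 1)) (Icc 0 a) S := fun s hs =>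
      ⟨hs.1, le_rfl, by simpa using hs.2⟩
    have := eqOn_of_exp_eqOn (isPreconnected_Icc (a := (0 : ℝ)) (b := a))
      (ℓ₁ := fun s => A (s, s + 1) + c) (ℓ₂ := fun s => θ (γ s))
      ((hA.comp (by fun_prop) hms).add continuousOn_const)
      (hθ.comp_continuousOn (hγ.mono (Icc_subset_Icc le_rfl (by linarith))))
      (fun s hs => by
        rw [hB _ (hms hs), hexp, hH s hs]) (a := 0) ⟨le_rfl, ha⟩ (by simp [hc])
    exact this ⟨ha, le_rfl⟩
  have hleft : (A (0, a + 1) + c).im ∈ Icc 0 Real.pi := by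
    have hms : MapsTo (fun s : ℝ => ((0 : ℝ), s)) (Icc 1 (a + 1)) S := fun s hs =>
      ⟨le_rfl, by simpa using hs.1, hs.2⟩
    refine im_mem_Icc_of_exp_im_nonneg (isPreconnected_Icc (a := (1 : ℝ)) (b := a + 1))
      (ℓ := fun s => A (0, s) + c) ((hA.comp (by fun_prop) hms).add continuousOn_const)
      (fun s hs => ?_) (a := 1) ⟨le_rfl, by linarith⟩ ⟨by linarith, le_rfl⟩ (by simpa [hc] using h0)
    rw [hB _ (hms hs)]
    simpa [planeVec] using hlow s ⟨by linarith [hs.1], hs.2⟩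
  rw [← hdiag]
  have hms : MapsTo (fun s : ℝ => (s, a + 1)) (Icc 0 a) S := fun s hs =>
    ⟨hs.1, by simpa using hs.2, le_rfl⟩
  refine im_mem_Icc_of_exp_im_nonneg (isPreconnected_Icc (a := (0 : ℝ)) (b := a))
    (ℓ := fun s => A (s, a + 1) + c) ((hA.comp (by fun_prop) hms).add continuousOn_const)
    (fun s hs => ?_) (a := 0) ⟨le_rfl, ha⟩ ⟨ha, le_rfl⟩ hleft
  rw [hB _ (hms hs)]
  simpa [planeVec] using hhigh s ⟨hs.1, by linarith [hs.2]⟩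

/-! ### Lifts of annulus homeomorphisms and the boundary of the strip -/

theorem bd0_eq_of_snd_eq_zero {z : StripA} (h : (z.2 : ℝ) = 0) : bd0 z.1 = z :=
  Prod.ext rfl (Subtype.ext h.symm)

theorem bd1_eq_of_snd_eq_one {z : StripA} (h : (z.2 : ℝ) = 1) : bd1 z.1 = z :=
  Prod.ext rfl (Subtype.ext h.symm)

theorem annProj_eq_iff {z w : StripA} : annProj z = annProj w ↔ ∃ m : ℤ, w = deckZ m z := by
  simp only [annProj, deckZ, Prod.ext_iff]
  constructor
  · rintro ⟨h1, h2⟩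
    rw [eq_comm, ← sub_eq_zero, ← AddCircle.coe_sub, AddCircle.coe_eq_zero_iff] at h1
    obtain ⟨m, hm⟩ := h1
    exact ⟨m, by rw [zsmul_eq_mul, mul_one] at hm; linarith, h2.symm⟩
  · rintro ⟨m, h1, h2⟩
    refine ⟨?_, h2.symm⟩
    rw [h1]
    simp

theorem deckZ_deckZ (m n : ℤ) (z : StripA) : deckZ m (deckZ n z) = deckZ (m + n) z := by
  simp only [deckZ]
  exact Prod.ext (by push_cast; ring) rfl

theorem deckZ_zero (z : StripA) : deckZ 0 z = z := by simp [deckZ]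

namespace AnnulusHomeo

theorem lift_deckZ (f : AnnulusHomeo) (m : ℤ) (z : StripA) :
    f.lift (deckZ m z) = deckZ m (f.lift z) := by
  have h1 : ∀ (k : ℤ) (w : StripA), deckZ (k + 1) w = deckT (deckZ k w) := fun k w => by
    simp [deckZ, deckT, add_assoc]
  have hT : Function.Injective deckT := fun a b hab => by
    simp only [deckT, Prod.mk.injEq, add_left_inj] at hab
    exact Prod.ext hab.1 hab.2
  induction m using Int.induction_on with
  | zero => simp [deckZ_zero]
  | succ i hi => rw [h1, h1, f.lift_deck, hi]
  | pred i hi =>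
    apply hT
    rw [← f.lift_deck, ← h1, ← h1, sub_add_cancel, hi]

theorem exists_circleDeg1Lift (f : AnnulusHomeo) {bd : ℝ → StripA} (hc : Continuous bd)
    (hfst : ∀ x, (bd x).1 = x) (hdeck : ∀ x, bd (x + 1) = deckT (bd x))
    (hinv : ∀ x, f.lift (bd x) = bd (f.lift (bd x)).1) :
    ∃ φ : CircleDeg1Lift, Continuous φ ∧ ∀ x, f.lift (bd x) = bd (φ x) := by
  set φ : ℝ → ℝ := fun x => (f.lift (bd x)).1 with hφ
  have hφc : Continuous φ := by fun_prop
  have h1 : ∀ x, φ (x + 1) = φ x + 1 := fun x => by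
    simp only [hφ, hdeck, f.lift_deck]
    rfl
  have hinj : Function.Injective φ := fun x y hxy => by
    have : f.lift (bd x) = f.lift (bd y) := by
      rw [hinv x, hinv y]
      exact congrArg bd hxy
    rw [← hfst x, ← hfst y, f.lift.injective this]
  have hmono : StrictMono φ := by
    rcases hφc.strictMono_of_inj hinj with h | h
    · exact h
    · have := h (zero_lt_one' ℝ)
      have h2 := h1 0
      rw [zero_add] at h2
      linarith
  exact ⟨⟨⟨φ, hmono.monotone⟩, h1⟩, hφc, hinv⟩

theorem continuous_bd0 : Continuous bd0 := by unfold bd0; fun_prop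

theorem continuous_bd1 : Continuous bd1 := by unfold bd1; fun_prop

theorem exists_circleDeg1Lift_bd0 (f : AnnulusHomeo) :
    ∃ φ : CircleDeg1Lift, Continuous φ ∧ ∀ x, f.lift (bd0 x) = bd0 (φ x) :=
  f.exists_circleDeg1Lift continuous_bd0 (fun _ => rfl) (fun _ => rfl)
    fun x => (bd0_eq_of_snd_eq_zero (f.lift_bd0 (bd0 x) rfl)).symm

theorem lift_symm_bd0 (f : AnnulusHomeo) (z : StripA) (hz : (z.2 : ℝ) = 0) :
    ((f.lift.symm z).2 : ℝ) = 0 := by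
  obtain ⟨φ, hc, h⟩ := f.exists_circleDeg1Lift_bd0
  obtain ⟨x, hx⟩ := φ.continuous_iff_surjective.1 hc z.1
  have : f.lift (bd0 x) = z := by rw [h, hx, bd0_eq_of_snd_eq_zero hz]
  rw [← this, Homeomorph.symm_apply_apply]
  rfl

/-- The inverse of an annulus homeomorphism, with the inverse lift. -/
def inv (f : AnnulusHomeo) : AnnulusHomeo where
  toFun := f.toFun.symm
  lift := f.lift.symm
  lift_proj z := by
    rw [Homeomorph.eq_symm_apply, ← f.lift_proj, Homeomorph.apply_symm_apply]
  lift_deck z := by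
    rw [Homeomorph.symm_apply_eq, f.lift_deck, Homeomorph.apply_symm_apply]
  lift_bd0 := f.lift_symm_bd0

/-- The lift of an annulus homeomorphism maps the upper boundary line to itself: otherwise a
punctured neighbourhood of an upper boundary point would contain an essential loop. -/
theorem lift_bd1 (f : AnnulusHomeo) (p : StripA) (hp : (p.2 : ℝ) = 1) :
    ((f.lift p).2 : ℝ) = 1 := by
  by_contra hne
  set z₀ := f.lift p with hz₀
  have hne0 : (z₀.2 : ℝ) ≠ 0 := fun h => by
    have := f.lift_symm_bd0 z₀ h
    rw [hz₀, Homeomorph.symm_apply_apply, hp] at this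
    exact one_ne_zero this
  have hpos : 0 < (z₀.2 : ℝ) := lt_of_le_of_ne z₀.2.2.1 (Ne.symm hne0)
  have hlt : (z₀.2 : ℝ) < 1 := lt_of_le_of_ne z₀.2.2.2 hne
  obtain ⟨r, hr, hr0, hr1⟩ : ∃ r : ℝ, 0 < r ∧ r ≤ z₀.2 ∧ r ≤ 1 - z₀.2 :=
    ⟨min z₀.2 (1 - z₀.2), lt_min hpos (by linarith), min_le_left _ _, min_le_right _ _⟩
  let c : ℝ → StripA := fun t => (z₀.1 + r * Real.cos t, ⟨z₀.2 + r * Real.sin t, by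
    have h1 := Real.sin_le_one t
    have h2 := Real.neg_one_le_sin t
    constructor <;> nlinarith⟩)
  have hcc : Continuous c := by unfold c; fun_prop
  let c' : ℝ → StripA := fun t => f.lift.symm (c t)
  have hcc' : Continuous c' := by unfold c'; fun_prop
  have hc'p : ∀ t, c' t ≠ p := fun t h => by
    have h' : c t = z₀ := by rw [hz₀, ← h, Homeomorph.apply_symm_apply]
    have e1 : z₀.1 + r * Real.cos t = z₀.1 := congrArg Prod.fst h'
    have e2 : (z₀.2 : ℝ) + r * Real.sin t = z₀.2 := congrArg (fun z : StripA => (z.2 : ℝ)) h'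
    have e3 : Real.cos t = 0 := by
      have : r * Real.cos t = 0 := by linarith
      exact (mul_eq_zero.1 this).resolve_left hr.ne'
    have e4 : Real.sin t = 0 := by
      have : r * Real.sin t = 0 := by linarith
      exact (mul_eq_zero.1 this).resolve_left hr.ne'
    have := Real.sin_sq_add_cos_sq t
    rw [e3, e4] at this
    norm_num at this
  let pr : ℝ → Icc (0 : ℝ) 1 := projIcc 0 1 zero_le_one
  have hpr : Continuous pr := continuous_projIcc
  let K : ℝ × ℝ → StripA := fun q =>
    (p.1 + pr q.1 * ((c' q.2).1 - p.1), ⟨pr q.1 * (c' q.2).2,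
      mul_nonneg (pr q.1).2.1 (c' q.2).2.2.1,
      mul_le_one₀ (pr q.1).2.2 (c' q.2).2.2.1 (c' q.2).2.2.2⟩)
  have hK : Continuous K := by unfold K; fun_prop
  have hKp : ∀ q, K q ≠ p := fun q h => by
    have e1 : p.1 + pr q.1 * ((c' q.2).1 - p.1) = p.1 := congrArg Prod.fst h
    have e2 : (pr q.1 : ℝ) * (c' q.2).2 = 1 :=
      (congrArg (fun z : StripA => (z.2 : ℝ)) h).trans hp
    have b1 := (pr q.1).2.2
    have b2 := (pr q.1).2.1
    have b3 := (c' q.2).2.2.2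
    have b4 := (c' q.2).2.2.1
    have e3 : (pr q.1 : ℝ) = 1 := by nlinarith
    rw [e3, one_mul] at e1 e2
    exact hc'p q.2 (Prod.ext (by linarith) (Subtype.ext (by rw [e2, hp])))
  let toP : StripA → ℝ × ℝ := fun z => (z.1, (z.2 : ℝ))
  have htoP : Continuous toP := by unfold toP; fun_prop
  have htoPi : Function.Injective toP := fun a b hab =>
    Prod.ext (Prod.ext_iff.1 hab).1 (Subtype.ext (Prod.ext_iff.1 hab).2)
  obtain ⟨ℓ, hℓ, hℓe⟩ := exists_continuousOn_log (convex_univ (𝕜 := ℝ) (E := ℝ × ℝ)) univ_nonempty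
    (φ := fun q => planeVec (toP z₀) (toP (f.lift (K q))))
    (continuous_planeVec continuousOn_const (by fun_prop))
    (fun q _ => planeVec_ne_zero fun h => hKp q (f.lift.injective (htoPi h)).symm)
  replace hℓ := continuousOn_univ.1 hℓ
  have hK0 : ∀ t, K (0, t) = K (0, 0) := fun t => by
    simp [K, pr]
  have hc2 : c' (2 * Real.pi) = c' 0 := by
    simp [c', c]
  have step1 : ℓ (0, 2 * Real.pi) = ℓ (0, 0) := by
    refine eqOn_of_exp_eqOn isPreconnected_univ (ℓ₁ := fun t => ℓ (0, t))
      (ℓ₂ := fun _ => ℓ (0, 0)) (by fun_prop) continuousOn_const (fun t _ => ?_) (mem_univ 0) rfl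
      (mem_univ (2 * Real.pi))
    rw [hℓe _ trivial, hℓe _ trivial, hK0]
  have step2 : ℓ (1, 2 * Real.pi) = ℓ (1, 0) := by
    refine eqOn_of_exp_eqOn isPreconnected_univ (ℓ₁ := fun s => ℓ (s, 2 * Real.pi))
      (ℓ₂ := fun s => ℓ (s, 0)) (by fun_prop) (by fun_prop) (fun s _ => ?_) (mem_univ 0) step1
      (mem_univ 1)
    rw [hℓe _ trivial, hℓe _ trivial]
    simp only [K, hc2]
  have hK1 : ∀ t, f.lift (K (1, t)) = c t := fun t => by
    have : K (1, t) = c' t := by simp [K, pr]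
    rw [this, Homeomorph.apply_symm_apply]
  have hval : ∀ t : ℝ, planeVec (toP z₀) (toP (c t)) = r * Complex.exp (t * Complex.I) :=
    fun t => by
      rw [Complex.exp_mul_I]
      apply Complex.ext <;>
        simp [planeVec, toP, c, Complex.cos_ofReal_re, Complex.sin_ofReal_re,
          Complex.cos_ofReal_im, Complex.sin_ofReal_im]
  have step3 : ℓ (1, 2 * Real.pi) = ℓ (1, 0) + (2 * Real.pi : ℝ) * Complex.I := by
    refine eqOn_of_exp_eqOn isPreconnected_univ (ℓ₁ := fun t => ℓ (1, t))
      (ℓ₂ := fun t : ℝ => ℓ (1, 0) + t * Complex.I) (by fun_prop) (by fun_prop) (fun t _ => ?_)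
      (mem_univ 0) (by simp) (mem_univ (2 * Real.pi))
    rw [Complex.exp_add, hℓe _ trivial, hℓe _ trivial, hK1, hK1, hval, hval]
    simp
  rw [step2] at step3
  have := congrArg Complex.im step3
  simp at this

theorem lift_symm_bd1 (f : AnnulusHomeo) (z : StripA) (hz : (z.2 : ℝ) = 1) :
    ((f.lift.symm z).2 : ℝ) = 1 := f.inv.lift_bd1 z hz

theorem exists_circleDeg1Lift_bd1 (f : AnnulusHomeo) :
    ∃ φ : CircleDeg1Lift, Continuous φ ∧ ∀ x, f.lift (bd1 x) = bd1 (φ x) :=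
  f.exists_circleDeg1Lift continuous_bd1 (fun _ => rfl) (fun _ => rfl)
    fun x => (bd1_eq_of_snd_eq_one (f.lift_bd1 (bd1 x) rfl)).symm

/-- The inverse of an annulus homeomorphism conjugated by the reflection `(x, y) ↦ (-x, y)`. -/
def mirrorInv (f : AnnulusHomeo) : AnnulusHomeo where
  toFun := (((Homeomorph.neg 𝕋).prodCongr (Homeomorph.refl _)).trans f.toFun.symm).trans
    ((Homeomorph.neg 𝕋).prodCongr (Homeomorph.refl _))
  lift := (((Homeomorph.neg ℝ).prodCongr (Homeomorph.refl _)).trans f.lift.symm).trans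
    ((Homeomorph.neg ℝ).prodCongr (Homeomorph.refl _))
  lift_proj z := by
    have := f.inv.lift_proj (-z.1, z.2)
    simp only [inv, annProj, Prod.ext_iff, AddCircle.coe_neg] at this
    simp only [annProj, Homeomorph.trans_apply, Homeomorph.coe_prodCongr, Prod.map_apply',
      Homeomorph.coe_neg, Homeomorph.refl_apply, AddCircle.coe_neg]
    exact Prod.ext (congrArg Neg.neg this.1) this.2
  lift_deck z := by
    have := f.inv.lift_deckZ (-1) (-z.1, z.2)
    have e : deckZ (-1) (-z.1, z.2) = (-(z.1 + 1), z.2) :=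
      Prod.ext (by simp only [deckZ]; push_cast; ring) rfl
    rw [e] at this
    simp only [inv, deckZ, Prod.ext_iff] at this
    simp only [deckT, Homeomorph.trans_apply, Homeomorph.coe_prodCongr, Prod.map_apply',
      Homeomorph.coe_neg, Homeomorph.refl_apply]
    refine Prod.ext ?_ this.2
    have h1 := this.1
    push_cast at h1
    simp only [id] at *
    linarith
  lift_bd0 z hz := f.lift_symm_bd0 (-z.1, z.2) hz

theorem mirrorInv_lift (f : AnnulusHomeo) (z : StripA) :
    f.mirrorInv.lift z = (-(f.lift.symm (-z.1, z.2)).1, (f.lift.symm (-z.1, z.2)).2) := rfl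

theorem mirrorInv_toFun (f : AnnulusHomeo) :
    ⇑f.mirrorInv.toFun = Prod.map Neg.neg id ∘ f.toFun.symm ∘ Prod.map Neg.neg id := rfl

theorem measurePreserving_mirrorInv {f : AnnulusHomeo}
    (hf : MeasurePreserving f.toFun volume volume) :
    MeasurePreserving f.mirrorInv.toFun volume volume := by
  have hneg : MeasurePreserving (Prod.map Neg.neg id : Ann → Ann) volume volume :=
    (Measure.measurePreserving_neg (volume : Measure 𝕋)).prod (MeasurePreserving.id volume)
  have hsymm : MeasurePreserving f.toFun.symm volume volume :=
    MeasurePreserving.symm f.toFun.toMeasurableEquiv hf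
  rw [mirrorInv_toFun]
  exact hneg.comp (hsymm.comp hneg)

end AnnulusHomeo

/-! ### A point drifting from the lower to the upper boundary -/

/-- The translation `y ↦ y + ε` modulo `1` preserves Lebesgue measure on `[0,1]`. -/
theorem exists_measurePreserving_shift (ε : ℝ) (hε : 0 < ε) :
    ∃ s : Icc (0 : ℝ) 1 → Icc (0 : ℝ) 1, MeasurePreserving s volume volume ∧
      ∀ y : Icc (0 : ℝ) 1, (y : ℝ) + ε < 1 → (s y : ℝ) = y + ε := by
  let m : Icc (0 : ℝ) 1 → 𝕋 := fun y => ((y : ℝ) : 𝕋)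
  have hm : MeasurePreserving m volume volume := by
    have h1 : MeasurePreserving ((↑) : Icc (0 : ℝ) 1 → ℝ) volume
        (volume.restrict (Ioc (0 : ℝ) (0 + 1))) := by
      rw [zero_add, restrict_Ioc_eq_restrict_Icc]
      exact measurePreserving_subtype_coe measurableSet_Icc
    exact (AddCircle.measurePreserving_mk 1 0).comp h1
  let j : 𝕋 → Icc (0 : ℝ) 1 := fun x =>
    ⟨AddCircle.measurableEquivIco 1 0 x, (AddCircle.measurableEquivIco 1 0 x).2.1, by
      simpa using (AddCircle.measurableEquivIco (1 : ℝ) 0 x).2.2.le⟩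
  have hjm : Measurable j :=
    (measurable_subtype_coe.comp (AddCircle.measurableEquivIco 1 0).measurable).subtype_mk
  have hj_apply : ∀ y : ℝ, 0 ≤ y → y < 1 → (j (y : 𝕋) : ℝ) = y := fun y h0 h1 => by
    have : (j (y : 𝕋) : ℝ) = Int.fract (y / 1) * 1 := AddCircle.coe_equivIco_mk_apply 1 y
    rw [this, div_one, mul_one, Int.fract_eq_self.2 ⟨h0, h1⟩]
  have hj : MeasurePreserving j volume volume := by
    refine ⟨hjm, ?_⟩
    rw [← hm.map_eq, Measure.map_map hjm hm.measurable]
    have : j ∘ m =ᵐ[volume] id := by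
      have h1 : ∀ᵐ y : Icc (0 : ℝ) 1, (y : ℝ) ≠ 1 := by
        simp [ae_iff]
      filter_upwards [h1] with y hy
      exact Subtype.ext (hj_apply y y.2.1 (lt_of_le_of_ne y.2.2 hy))
    rw [Measure.map_congr this, Measure.map_id]
  refine ⟨j ∘ (fun x => (ε : 𝕋) + x) ∘ m,
    hj.comp ((measurePreserving_add_left volume (ε : 𝕋)).comp hm), fun y hy => ?_⟩
  have h2 : (ε : 𝕋) + m y = (((y : ℝ) + ε : ℝ) : 𝕋) := by
    rw [AddCircle.coe_add, add_comm]
  simp only [Function.comp_apply, h2]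
  exact hj_apply _ (by linarith [y.2.1]) hy

namespace AnnulusHomeo

/-- The extension of the lift to the plane that preserves heights outside the strip. -/
noncomputable def planeExt (f : AnnulusHomeo) (z : ℝ × ℝ) : ℝ × ℝ :=
  ((f.lift (z.1, projIcc 0 1 zero_le_one z.2)).1,
    ((f.lift (z.1, projIcc 0 1 zero_le_one z.2)).2 : ℝ) +
      (z.2 - (projIcc (0 : ℝ) 1 zero_le_one z.2 : ℝ)))

theorem continuous_planeExt (f : AnnulusHomeo) : Continuous f.planeExt := by
  have : Continuous (projIcc (0 : ℝ) 1 zero_le_one) := continuous_projIcc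
  unfold planeExt
  fun_prop

theorem planeExt_coe (f : AnnulusHomeo) (z : StripA) :
    f.planeExt (z.1, (z.2 : ℝ)) = ((f.lift z).1, ((f.lift z).2 : ℝ)) := by
  simp [planeExt]

theorem planeExt_of_nonpos (f : AnnulusHomeo) {z : ℝ × ℝ} (hz : z.2 ≤ 0) :
    f.planeExt z = ((f.lift (bd0 z.1)).1, z.2) := by
  have h : (z.1, projIcc (0 : ℝ) 1 zero_le_one z.2) = bd0 z.1 := by
    rw [projIcc_of_le_left _ hz]; rfl
  have h0 : ((f.lift (bd0 z.1)).2 : ℝ) = 0 := f.lift_bd0 _ rfl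
  unfold planeExt
  rw [h, h0, projIcc_of_le_left _ hz]
  simp

theorem planeExt_of_one_le (f : AnnulusHomeo) {z : ℝ × ℝ} (hz : 1 ≤ z.2) :
    f.planeExt z = ((f.lift (bd1 z.1)).1, z.2) := by
  have h : (z.1, projIcc (0 : ℝ) 1 zero_le_one z.2) = bd1 z.1 := by
    rw [projIcc_of_right_le _ hz]; rfl
  have h0 : ((f.lift (bd1 z.1)).2 : ℝ) = 1 := f.lift_bd1 _ rfl
  unfold planeExt
  rw [h, h0, projIcc_of_right_le _ hz]
  simp

theorem planeExt_of_mem (f : AnnulusHomeo) {z : ℝ × ℝ} (hz : z.2 ∈ Icc (0 : ℝ) 1) :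
    f.planeExt z = ((f.lift (z.1, ⟨z.2, hz⟩)).1, ((f.lift (z.1, ⟨z.2, hz⟩)).2 : ℝ)) :=
  f.planeExt_coe (z.1, ⟨z.2, hz⟩)

theorem inv_planeExt_planeExt (f : AnnulusHomeo) (z : ℝ × ℝ) :
    f.inv.planeExt (f.planeExt z) = z := by
  rcases le_total z.2 0 with h0 | h0
  · rw [f.planeExt_of_nonpos h0, f.inv.planeExt_of_nonpos (z := ((f.lift (bd0 z.1)).1, z.2)) h0]
    have : bd0 (f.lift (bd0 z.1)).1 = f.lift (bd0 z.1) :=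
      bd0_eq_of_snd_eq_zero (f.lift_bd0 _ rfl)
    simp only [this, inv, Homeomorph.symm_apply_apply]
    rfl
  rcases le_total 1 z.2 with h1 | h1
  · rw [f.planeExt_of_one_le h1, f.inv.planeExt_of_one_le (z := ((f.lift (bd1 z.1)).1, z.2)) h1]
    have : bd1 (f.lift (bd1 z.1)).1 = f.lift (bd1 z.1) :=
      bd1_eq_of_snd_eq_one (f.lift_bd1 _ rfl)
    simp only [this, inv, Homeomorph.symm_apply_apply]
    rfl
  · rw [f.planeExt_of_mem ⟨h0, h1⟩, f.inv.planeExt_coe]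
    simp only [inv, Homeomorph.symm_apply_apply]

theorem planeExt_injective (f : AnnulusHomeo) : Function.Injective f.planeExt :=
  Function.LeftInverse.injective f.inv_planeExt_planeExt

theorem le_planeExt_snd (f : AnnulusHomeo) {z : ℝ × ℝ} {c : ℝ} (hc : c ≤ 0) (h : c ≤ z.2) :
    c ≤ (f.planeExt z).2 := by
  rcases le_total z.2 0 with h0 | h0
  · rwa [f.planeExt_of_nonpos h0]
  rcases le_total 1 z.2 with h1 | h1
  · rwa [f.planeExt_of_one_le h1]
  · rw [f.planeExt_of_mem ⟨h0, h1⟩]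
    exact hc.trans (f.lift (z.1, ⟨z.2, _⟩)).2.2.1

theorem planeExt_snd_le (f : AnnulusHomeo) {z : ℝ × ℝ} {c : ℝ} (hc : 1 ≤ c) (h : z.2 ≤ c) :
    (f.planeExt z).2 ≤ c := by
  rcases le_total z.2 0 with h0 | h0
  · rwa [f.planeExt_of_nonpos h0]
  rcases le_total 1 z.2 with h1 | h1
  · rwa [f.planeExt_of_one_le h1]
  · rw [f.planeExt_of_mem ⟨h0, h1⟩]
    exact (f.lift (z.1, ⟨z.2, _⟩)).2.2.2.trans hc

/-- The extended lift followed by the vertical translation by `ε`. -/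
noncomputable def push (f : AnnulusHomeo) (ε : ℝ) (z : ℝ × ℝ) : ℝ × ℝ :=
  ((f.planeExt z).1, (f.planeExt z).2 + ε)

theorem continuous_push (f : AnnulusHomeo) (ε : ℝ) : Continuous (f.push ε) := by
  have := f.continuous_planeExt
  unfold push
  fun_prop

theorem push_injective (f : AnnulusHomeo) (ε : ℝ) : Function.Injective (f.push ε) := by
  intro z w h
  simp only [push, Prod.mk.injEq, add_left_inj] at h
  exact f.planeExt_injective (Prod.ext h.1 h.2)

/-- By Poincaré recurrence, pushing an area-preserving homeomorphism upwards drives some point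
from near the lower boundary past the upper one. -/
theorem exists_push_iterate_ge_one {f : AnnulusHomeo} (hf : MeasurePreserving f.toFun volume volume)
    {ε : ℝ} (hε : 0 < ε) (hε1 : ε ≤ 1) :
    ∃ z : ℝ × ℝ, z.2 ∈ Ico 0 ε ∧ ∃ n : ℕ, 1 ≤ ((f.push ε)^[n] z).2 := by
  by_contra! hcon
  obtain ⟨s, hs, hsε⟩ := exists_measurePreserving_shift ε hε
  have hK : MeasurePreserving (Prod.map id s ∘ f.toFun : Ann → Ann) volume volume :=
    ((MeasurePreserving.id (volume : Measure 𝕋)).prod hs).comp hf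
  let E : Set Ann := {z | (z.2 : ℝ) < ε}
  have hEo : IsOpen E := isOpen_lt (by fun_prop) continuous_const
  have hEv : volume E ≠ 0 := by
    have hE : E = univ ×ˢ (((↑) : Icc (0 : ℝ) 1 → ℝ) ⁻¹' Iio ε) := by ext; simp [E]
    have hpre : (volume : Measure (Icc (0 : ℝ) 1)) (((↑) : Icc (0 : ℝ) 1 → ℝ) ⁻¹' Iio ε) =
        volume.restrict (Icc (0 : ℝ) 1) (Iio ε) :=
      (measurePreserving_subtype_coe (μa := volume)
        (measurableSet_Icc (a := (0 : ℝ)) (b := 1))).measure_preimage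
        measurableSet_Iio.nullMeasurableSet
    rw [hE, Measure.volume_eq_prod, Measure.prod_prod, hpre,
      Measure.restrict_apply measurableSet_Iio]
    have : Iio ε ∩ Icc 0 1 = Ico 0 ε := by
      ext y
      simp only [mem_inter_iff, mem_Iio, mem_Icc, mem_Ico]
      constructor
      · rintro ⟨h1, h2, h3⟩; exact ⟨h2, h1⟩
      · rintro ⟨h1, h2⟩; exact ⟨h2, h1, by linarith⟩
    rw [this, Real.volume_Ico]
    simp [hε]
  obtain ⟨z, hz, n, hn, hzn⟩ := hK.exists_mem_iterate_mem hEo.measurableSet.nullMeasurableSet hEv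
  obtain ⟨x, hx⟩ := QuotientAddGroup.mk_surjective z.1
  have hzx : annProj (x, z.2) = z := Prod.ext hx rfl
  have key : ∀ k : ℕ, ∃ w : StripA, (f.push ε)^[k] (x, z.2) = (w.1, (w.2 : ℝ)) ∧
      annProj w = (Prod.map id s ∘ f.toFun)^[k] z ∧ (0 < k → ε ≤ w.2) := by
    intro k
    induction k with
    | zero => exact ⟨(x, z.2), rfl, hzx, fun h => absurd h (lt_irrefl _)⟩
    | succ k ih =>
      obtain ⟨w, hw, hwK, -⟩ := ih
      have hlt := hcon (x, z.2) ⟨z.2.2.1, hz⟩ (k + 1)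
      rw [Function.iterate_succ_apply', hw, push, f.planeExt_coe] at hlt
      refine ⟨((f.lift w).1, ⟨(f.lift w).2 + ε, by linarith [(f.lift w).2.2.1], hlt.le⟩), ?_, ?_,
        fun _ => by simpa using (f.lift w).2.2.1⟩
      · rw [Function.iterate_succ_apply', hw, push, f.planeExt_coe]
      · rw [Function.iterate_succ_apply', ← hwK, Function.comp_apply, ← f.lift_proj]
        exact Prod.ext rfl (Subtype.ext (hsε _ hlt).symm)
  obtain ⟨w, -, hw2, hw3⟩ := key n
  rw [← hw2] at hzn
  have h1 : (w.2 : ℝ) < ε := hzn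
  linarith [hw3 (Nat.pos_of_ne_zero hn)]

end AnnulusHomeo

/-! ### A curve joining the two boundaries -/

namespace AnnulusHomeo

theorem push_snd_lower (f : AnnulusHomeo) {ε c : ℝ} (hε : 0 < ε) (hc : c ≤ 0) {n : ℕ} (hn : 0 < n)
    {z : ℝ × ℝ} (hz : c ≤ z.2) : c + ε ≤ ((f.push ε)^[n] z).2 := by
  induction n, hn using Nat.le_induction with
  | base => exact add_le_add_left (f.le_planeExt_snd hc hz) ε
  | succ n _ ih =>
    rw [Function.iterate_succ_apply']
    exact add_le_add_left (f.le_planeExt_snd hc (by linarith)) ε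

/-- A point drifting across the strip can be placed on an injective curve `γ` with
`γ (t + 1) = push (γ t)` whose first point is lowest and whose last point is highest. -/
theorem exists_curve (f : AnnulusHomeo) {ε : ℝ} (hε : 0 < ε) {w₀ w₁ : ℝ × ℝ}
    (hw : f.push ε w₀ = w₁) (hw₀ : w₀.2 ≤ 0) (hw₁ : w₁.2 = w₀.2 + ε) {n : ℕ}
    (hn : 1 ≤ ((f.push ε)^[n] w₁).2) :
    ∃ (γ : ℝ → ℝ × ℝ) (a : ℝ), 0 ≤ a ∧ ContinuousOn γ (Icc 0 (a + 1)) ∧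
      InjOn γ (Icc 0 (a + 1)) ∧ (∀ t ∈ Icc 0 a, γ (t + 1) = f.push ε (γ t)) ∧
      (∀ t ∈ Icc 0 (a + 1), (γ 0).2 ≤ (γ t).2) ∧
      (∀ t ∈ Icc 0 (a + 1), (γ t).2 ≤ (γ (a + 1)).2) ∧ (γ 0).2 ≤ 0 ∧ 1 ≤ (γ a).2 := by
  set P := f.push ε with hP
  have hPc : Continuous P := f.continuous_push ε
  let seg : ℝ → ℝ × ℝ := fun s => w₀ + s • (w₁ - w₀)
  have hseg : Continuous seg := by fun_prop
  have hseg0 : seg 0 = w₀ := by simp [seg]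
  have hseg1 : seg 1 = w₁ := by simp [seg]
  have hseg2 : ∀ s, (seg s).2 = w₀.2 + s * ε := fun s => by simp [seg, hw₁]
  let γ : ℝ → ℝ × ℝ := fun t => P^[⌊t⌋₊] (seg (Int.fract t))
  have hγ01 : ∀ t, 0 ≤ t → t < 1 → γ t = seg t := fun t h0 h1 => by
    simp only [γ, Nat.floor_eq_zero.2 h1, Int.fract_eq_self.2 ⟨h0, h1⟩, Function.iterate_zero, id]
  have hγstep : ∀ t, 0 ≤ t → γ (t + 1) = P (γ t) := fun t ht => by
    simp only [γ, Nat.floor_add_one ht, Int.fract_add_one, Function.iterate_succ_apply']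
  have hγ0 : γ 0 = w₀ := by rw [hγ01 0 le_rfl zero_lt_one, hseg0]
  have hγn : ∀ k : ℕ, γ k = P^[k] w₀ := fun k => by
    simp only [γ, Nat.floor_natCast, Int.fract_natCast, hseg0]
  have hpiece : ∀ k : ℕ, ∀ t ∈ Icc (k : ℝ) (k + 1), γ t = P^[k] (seg (t - k)) := by
    rintro k t ⟨h1, h2⟩
    rcases h2.lt_or_eq with h3 | rfl
    · have h0 : (0 : ℝ) ≤ t := (Nat.cast_nonneg k).trans h1
      have hfl : ⌊t⌋₊ = k := (Nat.floor_eq_iff h0).2 ⟨h1, h3⟩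
      have hfr : Int.fract t = t - k := Int.fract_eq_iff.2
        ⟨by linarith, by linarith, k, by push_cast; ring⟩
      simp only [γ, hfl, hfr]
    · rw [hγstep _ (Nat.cast_nonneg k), hγn, ← Function.iterate_succ_apply' P,
        Function.iterate_succ_apply, hw, add_sub_cancel_left, hseg1]
  have hcontN : ∀ k : ℕ, ContinuousOn γ (Icc 0 k) := by
    intro k
    induction k with
    | zero => simp
    | succ k ih =>
      have hk : ContinuousOn γ (Icc (k : ℝ) (k + 1)) :=
        ContinuousOn.congr (f := fun t => P^[k] (seg (t - k)))
          ((hPc.iterate k).comp (hseg.comp (by fun_prop))).continuousOn (hpiece k)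
      have := ih.union_of_isClosed hk isClosed_Icc isClosed_Icc
      rwa [Icc_union_Icc_eq_Icc (Nat.cast_nonneg k) (by linarith), ← Nat.cast_succ] at this
  have hcont : ∀ T : ℝ, ContinuousOn γ (Icc 0 T) := fun T =>
    (hcontN ⌈T⌉₊).mono (Icc_subset_Icc_right (Nat.le_ceil T))
  have hfract : ∀ t : ℝ, (seg (Int.fract t)).2 < w₀.2 + ε ∧ w₀.2 ≤ (seg (Int.fract t)).2 :=
    fun t => by
      rw [hseg2]
      constructor <;> nlinarith [Int.fract_nonneg t, Int.fract_lt_one t]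
  have hlow : ∀ t, 0 ≤ t → w₀.2 ≤ (γ t).2 := fun t ht => by
    rcases Nat.eq_zero_or_pos ⌊t⌋₊ with h | h
    · simp only [γ, h, Function.iterate_zero, id]
      exact (hfract t).2
    · linarith [f.push_snd_lower hε hw₀ h (hfract t).2]
  have hinj : InjOn γ (Ici 0) := by
    have key : ∀ s t : ℝ, 0 ≤ s → 0 ≤ t → γ s = γ t → ⌊s⌋₊ ≤ ⌊t⌋₊ → s = t := by
      intro s t hs ht hst hle
      obtain ⟨m, hm⟩ := Nat.exists_eq_add_of_le hle
      simp only [γ, hm, Function.iterate_add_apply] at hst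
      have h1 := (f.push_injective ε).iterate _ hst
      rcases Nat.eq_zero_or_pos m with rfl | hm0
      · have h2 := congrArg Prod.snd h1
        simp only [Function.iterate_zero, id, hseg2] at h2
        have h3 : Int.fract s = Int.fract t := by
          have := mul_right_cancel₀ hε.ne' (add_left_cancel h2)
          exact this
        have e1 : (⌊s⌋₊ : ℝ) + Int.fract s = s := by
          rw [natCast_floor_eq_intCast_floor hs, Int.floor_add_fract]
        have e2 : (⌊t⌋₊ : ℝ) + Int.fract t = t := by
          rw [natCast_floor_eq_intCast_floor ht, Int.floor_add_fract]
        rw [← e1, ← e2, hm, h3, add_zero]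
      · have h2 := f.push_snd_lower hε hw₀ hm0 (hfract t).2
        rw [← h1] at h2
        linarith [(hfract s).1]
    intro s hs t ht hst
    rcases le_total ⌊s⌋₊ ⌊t⌋₊ with h | h
    · exact key s t hs ht hst h
    · exact (key t s ht hs hst.symm h).symm
  obtain ⟨a, ha, hamax⟩ := isCompact_Icc.exists_isMaxOn
    (⟨0, le_rfl, by positivity⟩ : (Icc (0 : ℝ) (n + 1 : ℕ)).Nonempty)
    (continuous_snd.comp_continuousOn (hcont (n + 1 : ℕ)))
  have hM : 1 ≤ (γ a).2 := by
    have h1 : (γ (n + 1 : ℕ)).2 ≤ (γ a).2 :=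
      hamax (show ((n + 1 : ℕ) : ℝ) ∈ Icc (0 : ℝ) (n + 1 : ℕ) from ⟨by positivity, le_rfl⟩)
    rw [hγn, Function.iterate_succ_apply, hw] at h1
    exact hn.trans h1
  have htop : (γ (a + 1)).2 = (γ a).2 + ε := by
    rw [hγstep a ha.1, hP, push, f.planeExt_of_one_le hM]
  refine ⟨γ, a, ha.1, hcont _, hinj.mono fun t ht => ht.1, fun t ht => hγstep t ht.1,
    fun t ht => by rw [hγ0]; exact hlow t ht.1, fun t ht => ?_, by rwa [hγ0], hM⟩
  rw [htop]
  rcases lt_or_ge t 1 with h | h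
  · rw [hγ01 t ht.1 h, hseg2]
    nlinarith [ht.1]
  · have h1 : (γ (t - 1)).2 ≤ (γ a).2 :=
      hamax (show t - 1 ∈ Icc (0 : ℝ) (n + 1 : ℕ) from
        ⟨by linarith, by linarith [ht.2, ha.2]⟩)
    have h2 := hγstep (t - 1) (by linarith)
    rw [sub_add_cancel] at h2
    rw [h2]
    exact add_le_add_left (f.planeExt_snd_le hM h1) ε

/-! ### The displacement of a lift without fixed points -/

theorem planeVec_planeExt (f : AnnulusHomeo) (z : ℝ × ℝ) :
    planeVec z (f.planeExt z) = planeVec (z.1, (projIcc (0 : ℝ) 1 zero_le_one z.2 : ℝ))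
      (f.planeExt (z.1, (projIcc (0 : ℝ) 1 zero_le_one z.2 : ℝ))) := by
  apply Complex.ext <;> simp [planeVec, planeExt]
  ring

theorem planeExt_add_int (f : AnnulusHomeo) (x y : ℝ) (m : ℤ) :
    f.planeExt (x + m, y) = ((f.planeExt (x, y)).1 + m, (f.planeExt (x, y)).2) := by
  have h := f.lift_deckZ m (x, projIcc 0 1 zero_le_one y)
  simp only [deckZ] at h
  simp only [planeExt, h]

theorem planeExt_ne {f : AnnulusHomeo} (hfix : ∀ z, f.lift z ≠ z) (z : ℝ × ℝ) :
    planeVec z (f.planeExt z) ≠ 0 := by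
  rw [planeVec_planeExt]
  refine planeVec_ne_zero fun h => hfix (z.1, projIcc 0 1 zero_le_one z.2) ?_
  have h2 := f.planeExt_coe (z.1, projIcc 0 1 zero_le_one z.2)
  simp only at h2
  rw [h2] at h
  exact Prod.ext (congrArg Prod.fst h).symm (Subtype.ext (congrArg Prod.snd h).symm)

theorem continuous_displacement (f : AnnulusHomeo) :
    Continuous fun z => planeVec z (f.planeExt z) := by
  rw [← continuousOn_univ]
  exact continuous_planeVec continuousOn_id f.continuous_planeExt.continuousOn

theorem exists_le_norm_displacement {f : AnnulusHomeo} (hfix : ∀ z, f.lift z ≠ z) :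
    ∃ δ : ℝ, 0 < δ ∧ ∀ z, δ ≤ ‖planeVec z (f.planeExt z)‖ := by
  obtain ⟨w, hw, hmin⟩ := (isCompact_Icc (a := (0 : ℝ)) (b := 1)).prod
    (isCompact_Icc (a := (0 : ℝ)) (b := 1)) |>.exists_isMinOn ⟨(0, 0), by simp⟩
    f.continuous_displacement.norm.continuousOn
  refine ⟨_, norm_pos_iff.2 (planeExt_ne hfix w), fun z => ?_⟩
  have h1 : ∀ x y : ℝ, planeVec (x, y) (f.planeExt (x, y)) =
      planeVec (Int.fract x, y) (f.planeExt (Int.fract x, y)) := fun x y => by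
    have h := f.planeExt_add_int (Int.fract x) y ⌊x⌋
    rw [Int.fract_add_floor] at h
    rw [h]
    simp only [planeVec]
    congr 1
    linarith [Int.fract_add_floor x]
  rw [f.planeVec_planeExt z, h1 z.1]
  exact hmin (show (Int.fract z.1, (projIcc (0 : ℝ) 1 zero_le_one z.2 : ℝ)) ∈
    Icc (0 : ℝ) 1 ×ˢ Icc (0 : ℝ) 1 from
    ⟨⟨Int.fract_nonneg _, (Int.fract_lt_one _).le⟩, (projIcc 0 1 zero_le_one z.2).2⟩)

theorem displacement_of_nonpos (f : AnnulusHomeo) {z : ℝ × ℝ} (hz : z.2 ≤ 0) :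
    planeVec z (f.planeExt z) = (((f.lift (bd0 z.1)).1 - z.1 : ℝ) : ℂ) := by
  rw [f.planeExt_of_nonpos hz]
  apply Complex.ext <;> simp [planeVec]

theorem displacement_of_one_le (f : AnnulusHomeo) {z : ℝ × ℝ} (hz : 1 ≤ z.2) :
    planeVec z (f.planeExt z) = (((f.lift (bd1 z.1)).1 - z.1 : ℝ) : ℂ) := by
  rw [f.planeExt_of_one_le hz]
  apply Complex.ext <;> simp [planeVec]

end AnnulusHomeo

/-- The imaginary part of a logarithm is the argument up to a multiple of `2π`. -/
theorem exists_im_eq_arg_add {w v : ℂ} (h : Complex.exp w = v) :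
    ∃ k : ℤ, w.im = v.arg + k * (2 * Real.pi) := by
  have hv : v ≠ 0 := h ▸ Complex.exp_ne_zero w
  rw [← Complex.exp_log hv, Complex.exp_eq_exp_iff_exists_int] at h
  obtain ⟨k, hk⟩ := h
  refine ⟨k, ?_⟩
  rw [hk]
  simp [Complex.log_im]

namespace AnnulusHomeo

theorem im_log_displacement_of_nonpos {f : AnnulusHomeo}
    (h0 : ∀ x, (f.lift (bd0 x)).1 < x) {θ : ℝ × ℝ → ℂ} (hθ : Continuous θ)
    (he : ∀ z, Complex.exp (θ z) = planeVec z (f.planeExt z)) {z w : ℝ × ℝ} (hz : z.2 ≤ 0)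
    (hw : w.2 ≤ 0) : (θ z).im = (θ w).im := by
  have hconv : Convex ℝ {z : ℝ × ℝ | z.2 ≤ 0} :=
    convex_halfSpace_le (LinearMap.snd ℝ ℝ ℝ).isLinear 0
  refine im_log_eq_of_div_pos hconv.isPreconnected hθ.continuousOn
    f.continuous_displacement.continuousOn (fun x _ => he x) hw (fun x hx => ?_) hz
  rw [f.displacement_of_nonpos hx, f.displacement_of_nonpos hw]
  have h1 := sub_neg.2 (h0 x.1)
  have h2 := sub_neg.2 (h0 w.1)
  refine ⟨_, div_pos_of_neg_of_neg h1 h2, ?_⟩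
  rw [← Complex.ofReal_mul, div_mul_cancel₀ _ h2.ne]

theorem im_log_displacement_of_one_le {f : AnnulusHomeo}
    (h1 : ∀ x, x < (f.lift (bd1 x)).1) {θ : ℝ × ℝ → ℂ} (hθ : Continuous θ)
    (he : ∀ z, Complex.exp (θ z) = planeVec z (f.planeExt z)) {z w : ℝ × ℝ} (hz : 1 ≤ z.2)
    (hw : 1 ≤ w.2) : (θ z).im = (θ w).im := by
  have hconv : Convex ℝ {z : ℝ × ℝ | 1 ≤ z.2} :=
    convex_halfSpace_ge (LinearMap.snd ℝ ℝ ℝ).isLinear 1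
  refine im_log_eq_of_div_pos hconv.isPreconnected hθ.continuousOn
    f.continuous_displacement.continuousOn (fun x _ => he x) hw (fun x hx => ?_) hz
  rw [f.displacement_of_one_le hx, f.displacement_of_one_le hw]
  have h1' := sub_pos.2 (h1 x.1)
  have h2 := sub_pos.2 (h1 w.1)
  refine ⟨_, div_pos h1' h2, ?_⟩
  rw [← Complex.ofReal_mul, div_mul_cancel₀ _ h2.ne']

/-- The displacement of an area-preserving lift without fixed points turns by exactly half a turn
clockwise from the lower to the upper boundary. -/
theorem im_log_displacement_sub {f : AnnulusHomeo} (hf : MeasurePreserving f.toFun volume volume)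
    (h0 : ∀ x, (f.lift (bd0 x)).1 < x) (h1 : ∀ x, x < (f.lift (bd1 x)).1)
    (hfix : ∀ z, f.lift z ≠ z) {θ : ℝ × ℝ → ℂ} (hθ : Continuous θ)
    (he : ∀ z, Complex.exp (θ z) = planeVec z (f.planeExt z)) {z w : ℝ × ℝ} (hz : z.2 ≤ 0)
    (hw : 1 ≤ w.2) : (θ z).im - (θ w).im = Real.pi := by
  obtain ⟨δ, hδ, hδv⟩ := exists_le_norm_displacement hfix
  obtain ⟨ε, hε, hεm⟩ := exists_between (lt_min hδ zero_lt_one)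
  have hεδ : ε < δ := hεm.trans_le (min_le_left _ _)
  have hε1 : ε < 1 := hεm.trans_le (min_le_right _ _)
  set v : ℝ × ℝ → ℂ := fun z => planeVec z (f.planeExt z) with hv
  have hv0 : ∀ z, v z ≠ 0 := planeExt_ne hfix
  have hvc : Continuous v := f.continuous_displacement
  have hsmall : ∀ z, ‖(ε : ℂ) * Complex.I / v z‖ < 1 := fun z => by
    rw [norm_div, norm_mul, Complex.norm_I, mul_one, Complex.norm_real, Real.norm_of_nonneg hε.le,
      div_lt_one (norm_pos_iff.2 (hv0 z))]
    exact hεδ.trans_le (hδv z)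
  have hslit : ∀ z, 1 + (ε : ℂ) * Complex.I / v z ∈ Complex.slitPlane := fun z =>
    Complex.mem_slitPlane_of_norm_lt_one (hsmall z)
  have harg : ∀ z, |(1 + (ε : ℂ) * Complex.I / v z).arg| < Real.pi / 2 := fun z => by
    rw [Complex.abs_arg_lt_pi_div_two_iff]
    left
    have := (Complex.abs_re_le_norm _).trans_lt (hsmall z)
    rw [Complex.add_re, Complex.one_re]
    linarith [(abs_lt.1 this).1]
  obtain ⟨k, hk⟩ := exists_im_eq_arg_add (he z)
  obtain ⟨m, hm⟩ := exists_im_eq_arg_add (he w)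
  rw [f.displacement_of_nonpos hz, Complex.arg_ofReal_of_neg (sub_neg.2 (h0 _))] at hk
  rw [f.displacement_of_one_le hw, Complex.arg_ofReal_of_nonneg (sub_pos.2 (h1 _)).le] at hm
  let θε : ℝ × ℝ → ℂ := fun z =>
    θ z - k * (2 * Real.pi * Complex.I) + Complex.log (1 + (ε : ℂ) * Complex.I / v z)
  have hθεc : Continuous θε :=
    (hθ.sub continuous_const).add
      ((continuous_const.add (continuous_const.div hvc hv0)).clog hslit)
  have hθεe : ∀ z, Complex.exp (θε z) = planeVec z (f.push ε z) := fun z => by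
    simp only [θε]
    rw [Complex.exp_add, Complex.exp_sub, Complex.exp_int_mul_two_pi_mul_I, div_one, he,
      Complex.exp_log (Complex.slitPlane_ne_zero (hslit z))]
    change v z * (1 + ε * Complex.I / v z) = _
    rw [mul_add, mul_one, mul_div_cancel₀ _ (hv0 z)]
    apply Complex.ext <;> simp [v, planeVec, push]
    ring
  have hθεim : ∀ z, (θε z).im = (θ z).im - k * (2 * Real.pi) +
      (1 + (ε : ℂ) * Complex.I / v z).arg := fun z => by
    simp [θε, Complex.log_im]
  obtain ⟨w₁, hw₁, n, hn⟩ := exists_push_iterate_ge_one hf hε hε1.le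
  obtain ⟨φ, hφc, hφ⟩ := f.exists_circleDeg1Lift_bd0
  obtain ⟨x₀, hx₀⟩ := φ.continuous_iff_surjective.1 hφc w₁.1
  have hpush : f.push ε (x₀, w₁.2 - ε) = w₁ := by
    rw [push, f.planeExt_of_nonpos (by simpa using hw₁.2.le), hφ, hx₀]
    simp [bd0]
  obtain ⟨γ, a, ha, hγc, hinj, hstep, hlow, hhigh, hbot, htop⟩ :=
    f.exists_curve hε hpush (by simpa using hw₁.2.le) (by simp) hn
  have hstart : (θε (γ 0)).im ∈ Icc 0 Real.pi := by
    have e1 := im_log_displacement_of_nonpos h0 hθ he hbot hz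
    have hneg := sub_neg.2 (h0 (γ 0).1)
    have e2 : (1 + (ε : ℂ) * Complex.I / v (γ 0)).arg < 0 := by
      rw [Complex.arg_neg_iff]
      simp only [v]
      rw [f.displacement_of_nonpos hbot, Complex.add_im, Complex.one_im, zero_add,
        Complex.div_ofReal_im]
      simpa using div_neg_of_pos_of_neg hε hneg
    have e3 := (abs_lt.1 (harg (γ 0))).1
    rw [hθεim, e1, hk]
    constructor <;> linarith [Real.pi_pos]
  have hend := im_log_displacement_mem_Icc ha hγc hinj hstep hlow hhigh hθεc hθεe hstart
  rw [hθεim, im_log_displacement_of_one_le h1 hθ he htop hw, hm] at hend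
  obtain ⟨e1, e2⟩ := abs_lt.1 (harg (γ a))
  have hpi := Real.pi_pos
  have hlt : ((m - k : ℤ) : ℝ) < 1 := by
    push_cast
    nlinarith [hend.2]
  have hgt : (-1 : ℝ) < ((m - k : ℤ) : ℝ) := by
    push_cast
    nlinarith [hend.1]
  have hmk : m = k := by
    have h2 : m - k < 1 := by exact_mod_cast hlt
    have h3 : -1 < m - k := by exact_mod_cast hgt
    omega
  rw [hk, hm, hmk]
  ring

theorem mirrorInv_planeExt (f : AnnulusHomeo) (z : ℝ × ℝ) :
    f.mirrorInv.planeExt (-(f.planeExt z).1, (f.planeExt z).2) = (-z.1, z.2) := by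
  have h : ∀ w : ℝ × ℝ, f.mirrorInv.planeExt (-w.1, w.2) =
      (-(f.inv.planeExt w).1, (f.inv.planeExt w).2) := fun w => by
    simp only [planeExt, mirrorInv_lift, neg_neg, inv]
  rw [h, inv_planeExt_planeExt]

/-- **Poincaré–Birkhoff**: an area-preserving lift that moves the boundary lines in opposite
directions has a fixed point. -/
theorem exists_lift_eq_self {f : AnnulusHomeo} (hf : MeasurePreserving f.toFun volume volume)
    (h0 : ∀ x, (f.lift (bd0 x)).1 < x) (h1 : ∀ x, x < (f.lift (bd1 x)).1) :
    ∃ z, f.lift z = z := by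
  by_contra! hfix
  have hbd0 : ∀ x, (f.mirrorInv.lift (bd0 x)).1 < x := fun x => by
    have h := h0 (f.lift.symm (bd0 (-x))).1
    rw [bd0_eq_of_snd_eq_zero (f.lift_symm_bd0 (bd0 (-x)) rfl), Homeomorph.apply_symm_apply] at h
    change -x < _ at h
    rw [mirrorInv_lift]
    exact neg_lt.1 h
  have hbd1 : ∀ x, x < (f.mirrorInv.lift (bd1 x)).1 := fun x => by
    have h := h1 (f.lift.symm (bd1 (-x))).1
    rw [bd1_eq_of_snd_eq_one (f.lift_symm_bd1 (bd1 (-x)) rfl), Homeomorph.apply_symm_apply] at h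
    change _ < -x at h
    rw [mirrorInv_lift]
    exact lt_neg.1 h
  have hfix' : ∀ z, f.mirrorInv.lift z ≠ z := fun z h => by
    rw [mirrorInv_lift] at h
    obtain ⟨e1, e2⟩ := Prod.ext_iff.1 h
    have h2 : f.lift.symm (-z.1, z.2) = (-z.1, z.2) := Prod.ext (neg_eq_iff_eq_neg.1 e1) e2
    exact hfix _ ((Homeomorph.symm_apply_eq _).1 h2).symm
  obtain ⟨θ, hθ, hθe⟩ := exists_continuousOn_log (convex_univ (𝕜 := ℝ)) univ_nonempty
    f.mirrorInv.continuous_displacement.continuousOn fun z _ => planeExt_ne hfix' z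
  rw [continuousOn_univ] at hθ
  have hc := f.continuous_planeExt
  have hη : Continuous fun z => star (θ (-(f.planeExt z).1, (f.planeExt z).2)) := by fun_prop
  have hηe : ∀ z, Complex.exp (star (θ (-(f.planeExt z).1, (f.planeExt z).2))) =
      planeVec z (f.planeExt z) := fun z => by
    have h := Complex.exp_conj (θ (-(f.planeExt z).1, (f.planeExt z).2))
    rw [hθe _ (mem_univ _), mirrorInv_planeExt] at h
    refine h.trans ?_
    apply Complex.ext <;> simp [planeVec]
    ring
  have e0 : ((0 : ℝ), (0 : ℝ)).2 ≤ 0 := le_rfl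
  have e1 : (1 : ℝ) ≤ ((0 : ℝ), (1 : ℝ)).2 := le_rfl
  have hA := im_log_displacement_sub hf h0 h1 hfix hη hηe e0 e1
  have hB := im_log_displacement_sub (measurePreserving_mirrorInv hf) hbd0 hbd1 hfix' hθ
    (fun z => hθe z (mem_univ z))
    (z := (-(f.planeExt (0, 0)).1, (f.planeExt (0, 0)).2))
    (w := (-(f.planeExt (0, 1)).1, (f.planeExt (0, 1)).2))
    (by simp [f.planeExt_of_nonpos e0]) (by simp [f.planeExt_of_one_le e1])
  simp only [Complex.star_def, Complex.conj_im] at hA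
  linarith [Real.pi_pos]

end AnnulusHomeo

namespace AnnulusHomeo

theorem iter_natCast (f : AnnulusHomeo) (n : ℕ) : f.iter n = f.toFun^[n] := by
  funext z
  simp only [iter, zpow_natCast]
  rw [← Equiv.Perm.iterate_eq_pow]
  rfl

theorem liftIter_natCast (f : AnnulusHomeo) (n : ℕ) : f.liftIter n = f.lift^[n] := by
  funext z
  simp only [liftIter, zpow_natCast]
  rw [← Equiv.Perm.iterate_eq_pow]
  rfl

theorem lift_iterate_deckZ (f : AnnulusHomeo) (n : ℕ) (m : ℤ) (z : StripA) :
    f.lift^[n] (deckZ m z) = deckZ m (f.lift^[n] z) :=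
  Function.Commute.iterate_left (fun w => f.lift_deckZ m w) n z

theorem annProj_lift_iterate (f : AnnulusHomeo) (n : ℕ) (z : StripA) :
    annProj (f.lift^[n] z) = f.toFun^[n] (annProj z) :=
  Function.Semiconj.iterate_right (fun w => f.lift_proj w) n z

theorem lift_iterate_bd (f : AnnulusHomeo) {bd : ℝ → StripA} {φ : CircleDeg1Lift}
    (h : ∀ x, f.lift (bd x) = bd (φ x)) (n : ℕ) (x : ℝ) : f.lift^[n] (bd x) = bd (φ^[n] x) :=
  (Function.Semiconj.iterate_right (f := bd) (fun y => (h y).symm) n x).symm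

theorem annProj_deckZ (m : ℤ) (z : StripA) : annProj (deckZ m z) = annProj z :=
  (annProj_eq_iff.2 ⟨m, rfl⟩).symm

theorem lift_pow_apply (f : AnnulusHomeo) (n : ℕ) (z : StripA) : (f.lift ^ n) z = f.lift^[n] z :=
  congrFun (hom_coe_pow DFunLike.coe rfl (fun _ _ => rfl) f.lift n) z

theorem toFun_pow_apply (f : AnnulusHomeo) (n : ℕ) (z : Ann) : (f.toFun ^ n) z = f.toFun^[n] z :=
  congrFun (hom_coe_pow DFunLike.coe rfl (fun _ _ => rfl) f.toFun n) z

/-- The deck translation by `p` as a homeomorphism of the strip. -/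
noncomputable def deckHomeo (p : ℤ) : StripA ≃ₜ StripA :=
  (Homeomorph.addRight (p : ℝ)).prodCongr (Homeomorph.refl _)

theorem deckHomeo_apply (p : ℤ) (z : StripA) : deckHomeo p z = deckZ p z := rfl

/-- The `q`-th iterate of an annulus homeomorphism, with its lift translated back by `p`. -/
noncomputable def powTranslate (f : AnnulusHomeo) (q : ℕ) (p : ℤ) : AnnulusHomeo where
  toFun := f.toFun ^ q
  lift := (f.lift ^ q).trans (deckHomeo (-p))
  lift_proj z := by
    rw [Homeomorph.trans_apply, deckHomeo_apply, annProj_deckZ, lift_pow_apply, toFun_pow_apply,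
      annProj_lift_iterate]
  lift_deck z := by
    have h : ∀ w, deckT w = deckZ 1 w := fun w => by simp [deckT, deckZ]
    simp only [h, Homeomorph.trans_apply, deckHomeo_apply, lift_pow_apply, lift_iterate_deckZ,
      deckZ_deckZ, add_comm]
  lift_bd0 z hz := by
    obtain ⟨φ, -, hφ⟩ := f.exists_circleDeg1Lift_bd0
    rw [← bd0_eq_of_snd_eq_zero hz, Homeomorph.trans_apply, deckHomeo_apply, lift_pow_apply,
      f.lift_iterate_bd hφ]
    rfl

theorem powTranslate_lift (f : AnnulusHomeo) (q : ℕ) (p : ℤ) (z : StripA) :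
    (f.powTranslate q p).lift z = deckZ (-p) (f.lift^[q] z) := by
  rw [← lift_pow_apply]
  rfl

theorem measurePreserving_powTranslate {f : AnnulusHomeo}
    (hf : MeasurePreserving f.toFun volume volume) (q : ℕ) (p : ℤ) :
    MeasurePreserving (f.powTranslate q p).toFun volume volume := by
  have h : ⇑(f.powTranslate q p).toFun = f.toFun^[q] := funext (f.toFun_pow_apply q)
  rw [h]
  exact hf.iterate q

theorem translationNumber_eq_of_tendsto_lift (f : AnnulusHomeo) {bd : ℝ → StripA}
    (hbd : ∀ x, (bd x).1 = x) {φ : CircleDeg1Lift} (h : ∀ x, f.lift (bd x) = bd (φ x)) {ρ : ℝ}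
    (hρ : Tendsto (fun n : ℕ => ((f.liftIter (n : ℤ) (bd 0)).1 - 0) / (n : ℝ)) atTop (𝓝 ρ)) :
    φ.translationNumber = ρ := by
  refine φ.translationNumber_eq_of_tendsto₀ ?_
  simpa only [liftIter_natCast, f.lift_iterate_bd h, hbd, sub_zero] using hρ

theorem exists_lift_iterate_eq_deckZ_of_bd (f : AnnulusHomeo) {bd : ℝ → StripA}
    (hbd : ∀ (x : ℝ) (m : ℤ), bd (x + m) = deckZ m (bd x)) {φ : CircleDeg1Lift} (hφ : Continuous φ)
    (h : ∀ x, f.lift (bd x) = bd (φ x)) {p : ℤ} {q : ℕ} (hq : 0 < q)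
    (hρ : φ.translationNumber = p / q) : ∃ z, f.lift^[q] z = deckZ p z := by
  obtain ⟨x, hx⟩ := (φ.translationNumber_eq_rat_iff hφ hq).1 hρ
  rw [CircleDeg1Lift.coe_pow] at hx
  exact ⟨bd x, by rw [f.lift_iterate_bd h, hx, hbd]⟩

theorem exists_lift_iterate_eq_deckZ {f : AnnulusHomeo}
    (hf : MeasurePreserving f.toFun volume volume) {ρ₀ ρ₁ : ℝ} (h0 : HasRotNum0 f ρ₀)
    (h1 : HasRotNum1 f ρ₁) {p : ℤ} {q : ℕ} (hq : 0 < q)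
    (hpq : (p : ℝ) / (q : ℝ) ∈ Icc ρ₀ ρ₁) : ∃ z, f.lift^[q] z = deckZ p z := by
  obtain ⟨φ₀, hφ₀c, hφ₀⟩ := f.exists_circleDeg1Lift_bd0
  obtain ⟨φ₁, hφ₁c, hφ₁⟩ := f.exists_circleDeg1Lift_bd1
  have hτ₀ := f.translationNumber_eq_of_tendsto_lift (fun _ => rfl) hφ₀ (h0 0)
  have hτ₁ := f.translationNumber_eq_of_tendsto_lift (fun _ => rfl) hφ₁ (h1 0)
  rcases hpq.1.eq_or_lt with e0 | e0
  · exact f.exists_lift_iterate_eq_deckZ_of_bd (fun _ _ => rfl) hφ₀c hφ₀ hq (hτ₀.trans e0)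
  rcases hpq.2.eq_or_lt with e1 | e1
  · exact f.exists_lift_iterate_eq_deckZ_of_bd (fun _ _ => rfl) hφ₁c hφ₁ hq (hτ₁.trans e1.symm)
  have hq' : (0 : ℝ) < q := Nat.cast_pos.2 hq
  have l0 : (φ₀ ^ q).translationNumber < p := by
    rw [CircleDeg1Lift.translationNumber_pow, hτ₀, mul_comm]
    exact (lt_div_iff₀ hq').1 e0
  have l1 : (p : ℝ) < (φ₁ ^ q).translationNumber := by
    rw [CircleDeg1Lift.translationNumber_pow, hτ₁, mul_comm]
    exact (div_lt_iff₀ hq').1 e1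
  obtain ⟨z, hz⟩ := exists_lift_eq_self (measurePreserving_powTranslate hf q p)
    (fun x => by
      have := CircleDeg1Lift.map_lt_of_translationNumber_lt_int _ l0 x
      rw [CircleDeg1Lift.coe_pow] at this
      rw [powTranslate_lift, f.lift_iterate_bd hφ₀]
      simp only [deckZ, bd0]
      push_cast
      linarith)
    (fun x => by
      have := CircleDeg1Lift.lt_map_of_int_lt_translationNumber _ l1 x
      rw [CircleDeg1Lift.coe_pow] at this
      rw [powTranslate_lift, f.lift_iterate_bd hφ₁]
      simp only [deckZ, bd1]
      push_cast
      linarith)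
  rw [powTranslate_lift] at hz
  refine ⟨z, ?_⟩
  conv_rhs => rw [← hz]
  rw [deckZ_deckZ, add_neg_cancel, deckZ_zero]

theorem lift_iterate_mul (f : AnnulusHomeo) {n : ℕ} {m : ℤ} {z : StripA}
    (h : f.lift^[n] z = deckZ m z) (k : ℕ) : f.lift^[n * k] z = deckZ (k * m) z := by
  induction k with
  | zero => simp [deckZ_zero]
  | succ k ih =>
    rw [Nat.mul_succ, Function.iterate_add_apply, h, lift_iterate_deckZ, ih, deckZ_deckZ]
    congr 1
    push_cast
    ring

theorem dvd_of_lift_iterate_eq_deckZ {f : AnnulusHomeo} {p : ℤ} {q : ℕ}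
    (hcop : Nat.Coprime p.natAbs q) {z : StripA} (hz : f.lift^[q] z = deckZ p z) {j : ℕ} {m : ℤ}
    (hj : f.lift^[j] z = deckZ m z) : q ∣ j := by
  have h1 := f.lift_iterate_mul hz j
  have h2 := f.lift_iterate_mul hj q
  rw [mul_comm j q, h1] at h2
  have h3 : (j * p : ℤ) = q * m := by
    have h4 := congrArg Prod.fst h2
    simp only [deckZ, add_right_inj] at h4
    exact_mod_cast h4
  have h5 : (q : ℤ) ∣ j * p := ⟨m, h3⟩
  have h6 : q ∣ j * p.natAbs := by
    simpa [Int.natAbs_mul] using Int.natAbs_dvd_natAbs.2 h5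
  exact hcop.symm.dvd_of_dvd_mul_right h6

end AnnulusHomeo

/-- **Poincaré–Birkhoff theorem.** If an area-preserving homeomorphism of the annulus
isotopic to the identity has lift with rotation numbers `ρ₀ < ρ₁` on the two boundary
circles, then for every rational `p/q ∈ [ρ₀, ρ₁]` in lowest terms there is a periodic
orbit of type `(p,q)` for the lift. -/
theorem statement3 (f : AnnulusHomeo)
    (hArea : MeasurePreserving f.toFun volume volume)
    (ρ₀ ρ₁ : ℝ) (h0 : HasRotNum0 f ρ₀) (h1 : HasRotNum1 f ρ₁) (hlt : ρ₀ < ρ₁)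
    (p : ℤ) (q : ℕ) (hq : 1 ≤ q) (hcop : Nat.Coprime p.natAbs q)
    (hpq : (p : ℝ) / (q : ℝ) ∈ Set.Icc ρ₀ ρ₁) :
    ∃ z : Ann, f.iter (q : ℤ) z = z ∧ (∀ j : ℕ, 0 < j → j < q → f.iter (j : ℤ) z ≠ z) ∧
      ∀ w : StripA, annProj w = z → f.liftIter (q : ℤ) w = deckZ p w := by
  obtain ⟨w₀, hw₀⟩ := AnnulusHomeo.exists_lift_iterate_eq_deckZ hArea h0 h1 hq hpq
  have hper : f.toFun^[q] (annProj w₀) = annProj w₀ := by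
    rw [← f.annProj_lift_iterate, hw₀, AnnulusHomeo.annProj_deckZ]
  refine ⟨annProj w₀, by rwa [f.iter_natCast], fun j hj hjq hfix => ?_, fun w hw => ?_⟩
  · rw [f.iter_natCast, ← f.annProj_lift_iterate] at hfix
    obtain ⟨m, hm⟩ := annProj_eq_iff.1 hfix.symm
    exact absurd (Nat.le_of_dvd hj (AnnulusHomeo.dvd_of_lift_iterate_eq_deckZ hcop hw₀ hm))
      (not_le.2 hjq)
  · obtain ⟨m, rfl⟩ := annProj_eq_iff.1 hw.symm
    rw [f.liftIter_natCast, f.lift_iterate_deckZ, hw₀, deckZ_deckZ, deckZ_deckZ, add_comm]
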